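/- Let F be a field, W a finite-dimensional vector space over F, and fix natural numbers n, k, g with k ≥ 1 and k ≥ 2g − 1. Let V be a function assigning to each subset S of a fixed n-element index set a linear subspace V(S) of W, satisfying: (i) V(S₁) ∩ V(S₂) = V(S₁ ∩ S₂) for all S₁, S₂; (ii) V(∅) = 0; (iii) dim V(S) = k·|S| + 1 − g for every S with k·|S| ≥ 2g − 1. Then for any two distinct elements P ≠ Q of the index set, dist(V({P}), V({Q})) = 2(k + 1 − g). -/

import Mathlib

/-- The `s = 1` case: if `k ≥ 2g − 1`, then for distinct points `P ≠ Q`,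
`dist(V({P}), V({Q})) = 2(k + 1 − g)`. -/
theorem kk_dist_singletons (F W ι : Type*) [Field F] [AddCommGroup W] [Module F W]
    [FiniteDimensional F W] [Fintype ι] [DecidableEq ι] (n k g : ℕ)
    (hn : Fintype.card ι = n) (hk : 1 ≤ k) (hkg : (2 * g : ℤ) - 1 ≤ (k : ℤ))
    (V : Finset ι → Submodule F W)
    (hinter : ∀ S₁ S₂ : Finset ι, V S₁ ⊓ V S₂ = V (S₁ ∩ S₂))
    (hempty : V ∅ = ⊥)
    (hdim : ∀ S : Finset ι, (2 * g : ℤ) - 1 ≤ (k : ℤ) * S.card →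
      (Module.finrank F ↥(V S) : ℤ) = (k : ℤ) * S.card + 1 - g)
    (P Q : ι) (hPQ : P ≠ Q) :
    (Module.finrank F ↥(V {P} ⊔ V {Q}) : ℤ) - (Module.finrank F ↥(V {P} ⊓ V {Q}) : ℤ) =
      2 * ((k : ℤ) + 1 - g) := by
  have hbot : V {P} ⊓ V {Q} = ⊥ := by
    rw [hinter, Finset.singleton_inter_of_notMem (by simpa using hPQ), hempty]
  have hP := hdim {P} (by simpa using hkg)
  have hQ := hdim {Q} (by simpa using hkg)
  have hsum := Submodule.finrank_sup_add_finrank_inf_eq (V {P}) (V {Q})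
  rw [hbot, finrank_bot] at hsum ⊢
  simp only [Finset.card_singleton, Nat.cast_one, mul_one] at hP hQ
  omega
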